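/- arXiv:1009.3419 — 2 statements merged into one kernel-verified Lean document; each statement's English description precedes it below -/
import Mathlib

section
/- Define $\eta := (F)_\# \left(\frac{1}{2\pi^2}\mathcal{L}^2\lfloor B_1(0) \times \mathcal{L}^1\lfloor (0,2\pi)\right)$ where $F(x,\theta) = \omega_{x,\theta}$ with $\omega_{x,\theta}(t) = x\cos t + \sqrt{1-|x|^2}(\cos\theta,\sin\theta)\sin t$. Then $\eta$ is an incompressible generalized flow on the unit disc: for every $t \in [0,\pi]$, $(e_t)_\# \eta$ equals the normalized Lebesgue measure on $B_1(0)$. -/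
open Set MeasureTheory Real

/-- The unit vector `(cos θ, sin θ)` in the plane. -/
noncomputable def unitDir (θ : ℝ) : EuclideanSpace ℝ (Fin 2) :=
  (WithLp.equiv 2 (Fin 2 → ℝ)).symm ![Real.cos θ, Real.sin θ]

/-- Brenier's paths `ω_{x,θ}(t) = x cos t + √(1-|x|²) (cos θ, sin θ) sin t`. -/
noncomputable def brenierPath (x : EuclideanSpace ℝ (Fin 2)) (θ : ℝ) (t : ℝ) :
    EuclideanSpace ℝ (Fin 2) :=
  Real.cos t • x + (Real.sqrt (1 - ‖x‖ ^ 2) * Real.sin t) • unitDir θ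

local notation "E2" => EuclideanSpace ℝ (Fin 2)

theorem continuous_unitDir : Continuous unitDir := by
  unfold unitDir
  refine (PiLp.continuous_toLp 2 (fun _ : Fin 2 => ℝ)).comp ?_
  refine continuous_pi fun i => ?_
  fin_cases i
  · exact Real.continuous_cos
  · exact Real.continuous_sin

theorem norm_unitDir (θ : ℝ) : ‖unitDir θ‖ = 1 := by
  rw [EuclideanSpace.norm_eq]
  simp [unitDir, Fin.sum_univ_two]

theorem unitDir_sub_pi (θ : ℝ) : unitDir (θ - π) = - unitDir θ := by
  ext i
  fin_cases i <;> simp [unitDir, Real.cos_sub_pi, Real.sin_sub_pi]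

theorem polar_aux (h : E2 → ENNReal) (hh : Measurable h) :
    ∫⁻ y, h y = ∫⁻ θ in Ioo (-π) π, ∫⁻ s in Ioi (0:ℝ), ENNReal.ofReal s * h (s • unitDir θ) := by
  have e1 : ∫⁻ y, h y = ∫⁻ q : Fin 2 → ℝ, h (WithLp.toLp 2 q) :=
    ((PiLp.volume_preserving_toLp (Fin 2)).lintegral_comp hh).symm
  have hm : Measurable fun q : Fin 2 → ℝ => h (WithLp.toLp 2 q) :=
    hh.comp (PiLp.volume_preserving_toLp (Fin 2)).measurable
  have e2 : ∫⁻ q : Fin 2 → ℝ, h (WithLp.toLp 2 q) = ∫⁻ p : ℝ × ℝ, h (WithLp.toLp 2 ![p.1, p.2]) :=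
    (((volume_preserving_finTwoArrow ℝ).symm).lintegral_comp hm).symm
  rw [e1, e2, ← lintegral_comp_polarCoord_symm]
  have : polarCoord.target = Ioi (0:ℝ) ×ˢ Ioo (-π) π := rfl
  rw [this, Measure.volume_eq_prod, ← Measure.prod_restrict, lintegral_prod_symm]
  · refine lintegral_congr fun θ => lintegral_congr fun s => ?_
    simp only [smul_eq_mul]
    congr 2
    ext i
    fin_cases i <;> simp [unitDir, polarCoord]
  · refine Measurable.aemeasurable ?_
    have : Measurable fun p : ℝ × ℝ => h (WithLp.toLp 2 ![(polarCoord.symm p).1, (polarCoord.symm p).2]) := by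
      refine hh.comp ((PiLp.volume_preserving_toLp (Fin 2)).measurable.comp ?_)
      refine measurable_pi_lambda _ fun i => ?_
      fin_cases i <;> simp [polarCoord] <;> fun_prop
    simp only [smul_eq_mul]
    exact (by fun_prop : Measurable fun p : ℝ × ℝ => ENNReal.ofReal p.1).mul this

theorem polar_lint (h : E2 → ENNReal) (hh : Measurable h) :
    ∫⁻ y, h y = ∫⁻ θ in Ioo 0 (2*π), ∫⁻ s in Ioi (0:ℝ), ENNReal.ofReal s * h (s • unitDir θ) := by
  have e1 : ∫⁻ y, h y = ∫⁻ y, h (-y) :=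
    ((Measure.measurePreserving_neg (volume : Measure E2)).lintegral_comp hh).symm
  rw [e1, polar_aux (fun y => h (-y)) (hh.comp measurable_neg)]
  have mp := measurePreserving_sub_right (volume : Measure ℝ) π
  have := mp.setLIntegral_comp_emb (MeasurableEquiv.subRight π).measurableEmbedding
    (fun θ => ∫⁻ s in Ioi (0:ℝ), ENNReal.ofReal s * h (-(s • unitDir θ))) (Ioo 0 (2*π))
  have im : (fun x => x - π) '' Ioo 0 (2*π) = Ioo (-π) π := by
    rw [Set.image_sub_const_Ioo]; congr 1 <;> ring
  rw [im] at this
  rw [← this]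
  simp [unitDir_sub_pi]

theorem sub_lint (a : ℝ) (ha : 0 ≤ a) (g : ℝ → ENNReal) :
    ∫⁻ s in Ioi (0:ℝ), ENNReal.ofReal s * g s =
      ∫⁻ r in Ioi a, ENNReal.ofReal r * g (√(r^2 - a^2)) := by
  have pos : ∀ r ∈ Ioi a, 0 < r^2 - a^2 := fun r (hr : a < r) => by nlinarith
  have im : (fun r => √(r^2 - a^2)) '' Ioi a = Ioi 0 := by
    ext s
    constructor
    · rintro ⟨r, hr, rfl⟩
      exact Real.sqrt_pos.2 (pos r hr)
    · intro (hs : 0 < s)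
      refine ⟨√(s^2 + a^2), ?_, ?_⟩
      · exact Real.lt_sqrt_of_sq_lt (by nlinarith)
      · simp only
        rw [Real.sq_sqrt (by positivity), add_sub_cancel_right, Real.sqrt_sq hs.le]
  have := lintegral_image_eq_lintegral_abs_deriv_mul (s := Ioi a) (f := fun r => √(r^2 - a^2))
    (f' := fun r => (2 * r) / (2 * √(r^2 - a^2))) measurableSet_Ioi
    (fun r hr => by
      have h1 : HasDerivAt (fun r : ℝ => r^2 - a^2) (2 * r) r := by
        simpa using (hasDerivAt_pow 2 r).sub_const (a^2)
      exact (h1.sqrt (pos r hr).ne').hasDerivWithinAt)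
    (fun r hr r' hr' h => by
      have h1 := (Real.sqrt_inj (pos r hr).le (pos r' hr').le).1 h
      have hr0 : 0 < r := lt_of_le_of_lt ha hr
      have hr0' : 0 < r' := lt_of_le_of_lt ha hr'
      exact (sq_eq_sq₀ hr0.le hr0'.le).1 (by linarith))
    (fun s => ENNReal.ofReal s * g s)
  rw [im] at this
  rw [this]
  refine setLIntegral_congr_fun measurableSet_Ioi fun r hr => ?_
  have h0 := Real.sqrt_pos.2 (pos r hr)
  have hr0 : 0 < r := lt_of_le_of_lt ha hr
  rw [← mul_assoc, ← ENNReal.ofReal_mul (abs_nonneg _), abs_of_pos (by positivity)]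
  congr 2
  field_simp

theorem scale_lint (r : ℝ) (hr : 0 < r) (k : E2 → ENNReal) (hk : Measurable k) :
    ∫⁻ x, k x = ENNReal.ofReal (r^2) * ∫⁻ x, k (r • x) := by
  have h1 : ∫⁻ x, k (r • x) = ∫⁻ x, k x ∂(Measure.map (r • ·) (volume : Measure E2)) :=
    (lintegral_map hk (measurable_const_smul r)).symm
  rw [h1, Measure.map_addHaar_smul _ hr.ne', lintegral_smul_measure, smul_eq_mul, ← mul_assoc,
    ← ENNReal.ofReal_mul (by positivity), abs_of_pos (by positivity)]
  simp [hr.ne']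

theorem swap_lint (Φ : E2 → ℝ → ℝ → ENNReal)
    (mΦ : Measurable fun q : (E2 × ℝ) × ℝ => Φ q.1.1 q.1.2 q.2) (μ ν : Measure ℝ) [SFinite μ]
    [SFinite ν] :
    ∫⁻ x, ∫⁻ θ, ∫⁻ r, Φ x θ r ∂ν ∂μ = ∫⁻ r, ∫⁻ x, ∫⁻ θ, Φ x θ r ∂μ ∂volume ∂ν := by
  have a1 : ∀ x, ∫⁻ θ, ∫⁻ r, Φ x θ r ∂ν ∂μ = ∫⁻ r, ∫⁻ θ, Φ x θ r ∂μ ∂ν := by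
    intro x
    have m : Measurable (fun q : ℝ × ℝ => Φ x q.1 q.2) :=
      mΦ.comp (by fun_prop : Measurable fun q : ℝ × ℝ => ((x, q.1), q.2))
    exact lintegral_lintegral_swap (f := fun θ r => Φ x θ r) m.aemeasurable
  simp_rw [a1]
  have m : Measurable (fun q : (E2 × ℝ) × ℝ => Φ q.1.1 q.2 q.1.2) :=
    mΦ.comp (by fun_prop : Measurable fun q : (E2 × ℝ) × ℝ => ((q.1.1, q.2), q.1.2))
  have m2 : Measurable (fun q : E2 × ℝ => ∫⁻ θ, Φ q.1 θ q.2 ∂μ) := m.lintegral_prod_right'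
  exact lintegral_lintegral_swap (f := fun x r => ∫⁻ θ, Φ x θ r ∂μ) m2.aemeasurable

theorem key_lint (g : E2 × E2 → ENNReal) (hg : Measurable g) :
    ∫⁻ p, g p = ∫⁻ r in Ioi (0:ℝ), ENNReal.ofReal r * (ENNReal.ofReal (r^2) *
      ∫⁻ x in Metric.ball (0:E2) 1, ∫⁻ θ in Ioo 0 (2*π),
        g (r • x, (r * √(1 - ‖x‖^2)) • unitDir θ)) := by
  have mu : Measurable unitDir := continuous_unitDir.measurable
  obtain ⟨Φ, hΦ⟩ : ∃ Φ : E2 → ℝ → ℝ → ENNReal, ∀ x θ r, Φ x θ r =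
    if ‖x‖ < r then ENNReal.ofReal r * g (x, √(r^2 - ‖x‖^2) • unitDir θ) else 0 :=
      ⟨_, fun _ _ _ => rfl⟩
  have mΦ : Measurable fun q : (E2 × ℝ) × ℝ => Φ q.1.1 q.1.2 q.2 := by
    simp only [hΦ]
    refine Measurable.ite (measurableSet_lt (by fun_prop) (by fun_prop)) ?_ measurable_const
    refine Measurable.mul (by fun_prop) (hg.comp ?_)
    fun_prop
  have s1 : ∫⁻ p, g p = ∫⁻ x, ∫⁻ θ in Ioo 0 (2*π), ∫⁻ r in Ioi (0:ℝ), Φ x θ r := by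
    rw [Measure.volume_eq_prod, lintegral_prod _ hg.aemeasurable]
    refine lintegral_congr fun x => ?_
    refine (polar_lint (fun y => g (x, y))
      (hg.comp (by fun_prop : Measurable fun y : E2 => (x, y)))).trans ?_
    refine lintegral_congr fun θ => ?_
    rw [sub_lint ‖x‖ (norm_nonneg x) (fun s => g (x, s • unitDir θ))]
    have : Ioi ‖x‖ = Ioi ‖x‖ ∩ Ioi 0 := by
      ext r; simp only [mem_Ioi, mem_inter_iff]
      exact ⟨fun h => ⟨h, (norm_nonneg x).trans_lt h⟩, fun h => h.1⟩
    rw [this, ← setLIntegral_indicator measurableSet_Ioi]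
    refine lintegral_congr fun r => ?_
    simp [hΦ, indicator_apply]
  have s2 : ∫⁻ x, ∫⁻ θ in Ioo 0 (2*π), ∫⁻ r in Ioi (0:ℝ), Φ x θ r =
      ∫⁻ r in Ioi (0:ℝ), ∫⁻ x, ∫⁻ θ in Ioo 0 (2*π), Φ x θ r := 
    swap_lint _ mΦ _ _
  rw [s1, s2]
  refine setLIntegral_congr_fun measurableSet_Ioi fun r (hr : 0 < r) => ?_
  have mr : Measurable fun x => ∫⁻ θ in Ioo 0 (2*π), Φ x θ r :=
    Measurable.lintegral_prod_right' (f := fun q : E2 × ℝ => Φ q.1 q.2 r)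
      (mΦ.comp (by fun_prop : Measurable fun q : E2 × ℝ => (q, r)))
  rw [scale_lint r hr _ mr, mul_left_comm]
  congr 1
  rw [← lintegral_indicator Metric.isOpen_ball.measurableSet,
    ← lintegral_const_mul' _ _ ENNReal.ofReal_ne_top]
  refine lintegral_congr fun x => ?_
  have hn : ‖r • x‖ = r * ‖x‖ := by rw [norm_smul, Real.norm_of_nonneg hr.le]
  have hiff : ‖r • x‖ < r ↔ x ∈ Metric.ball (0:E2) 1 := by
    rw [hn, mem_ball_zero_iff]; exact mul_lt_iff_lt_one_right hr
  by_cases hx : x ∈ Metric.ball (0:E2) 1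
  · rw [indicator_of_mem hx, ← lintegral_const_mul' _ _ ENNReal.ofReal_ne_top]
    refine lintegral_congr fun θ => ?_
    have hs : √(r^2 - ‖r • x‖^2) = r * √(1 - ‖x‖^2) := by
      rw [hn, show r^2 - (r*‖x‖)^2 = r^2 * (1 - ‖x‖^2) by ring, Real.sqrt_mul (by positivity),
        Real.sqrt_sq hr.le]
    simp only [hΦ]
    rw [if_pos (hiff.2 hx), hs]
  · rw [indicator_of_notMem hx]
    simp only [hΦ]
    simp only [if_neg (fun h => hx (hiff.1 h))]
    simp

theorem rot_norm (c s : ℝ) (h : c^2 + s^2 = 1) (x y : E2) :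
    ‖c • x + s • y‖^2 + ‖(-s) • x + c • y‖^2 = ‖x‖^2 + ‖y‖^2 := by
  rw [norm_add_sq_real, norm_add_sq_real]
  simp only [norm_smul, inner_smul_left, inner_smul_right, mul_pow, Real.norm_eq_abs, sq_abs]
  simp
  linear_combination (‖x‖^2 + ‖y‖^2) * h

theorem rot_mp (c s : ℝ) (h : c^2 + s^2 = 1) :
    MeasurePreserving (fun p : E2 × E2 => (c • p.1 + s • p.2, (-s) • p.1 + c • p.2)) := by
  let f : WithLp 2 (E2 × E2) →ₗ[ℝ] WithLp 2 (E2 × E2) :=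
    { toFun := fun p => WithLp.toLp 2 (c • p.fst + s • p.snd, (-s) • p.fst + c • p.snd)
      map_add' := fun p q => by
        apply (WithLp.ofLp_injective 2)
        ext1 <;> simp <;> module
      map_smul' := fun a q => by
        apply (WithLp.ofLp_injective 2)
        ext1 <;> simp <;> module }
  have hf : ∀ p, ‖f p‖ = ‖p‖ := fun p => by
    rw [← sq_eq_sq₀ (norm_nonneg _) (norm_nonneg _), WithLp.prod_norm_sq_eq_of_L2,
      WithLp.prod_norm_sq_eq_of_L2]
    exact rot_norm c s h p.fst p.snd
  let fi : WithLp 2 (E2 × E2) →ₗᵢ[ℝ] WithLp 2 (E2 × E2) := ⟨f, hf⟩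
  let fe := fi.toLinearIsometryEquiv rfl
  exact ((WithLp.volume_preserving_ofLp E2 E2).comp fe.measurePreserving).comp
    (WithLp.volume_preserving_toLp E2 E2)

theorem main_lint (c s : ℝ) (h : c^2 + s^2 = 1) (f : E2 → ENNReal) (hf : Measurable f) :
    ∫⁻ x in Metric.ball (0:E2) 1, ∫⁻ θ in Ioo 0 (2*π), f (c • x + (√(1 - ‖x‖^2) * s) • unitDir θ)
     = ∫⁻ x in Metric.ball (0:E2) 1, ∫⁻ _ in Ioo 0 (2*π), f x := by
  let ρ : E2 × E2 → ℝ := fun p => √(‖p.1‖^2 + ‖p.2‖^2)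
  have mρ : Measurable ρ := by fun_prop
  let G : ℝ → ℝ → E2 × E2 → ENNReal := fun c s p =>
    if ρ p < 1 then f ((ρ p)⁻¹ • (c • p.1 + s • p.2)) else 0
  have mG : ∀ c s, Measurable (G c s) := fun c s =>
    Measurable.ite (measurableSet_lt mρ measurable_const) (hf.comp (by fun_prop)) measurable_const
  let K : ENNReal := ∫⁻ r in Ioo (0:ℝ) 1, ENNReal.ofReal r * ENNReal.ofReal (r^2)
  have hK0 : K ≠ 0 := by
    have : 0 < K := by
      rw [setLIntegral_pos_iff (by fun_prop)]
      have : Function.support (fun r => ENNReal.ofReal r * ENNReal.ofReal (r^2)) ∩ Ioo (0:ℝ) 1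
          = Ioo (0:ℝ) 1 := by
        refine inter_eq_right.2 fun r hr => ?_
        have := hr.1
        simp [this, this.ne']
      rw [this]; simp
    exact this.ne'
  have hKt : K ≠ ⊤ := by
    have : K ≤ ∫⁻ r in Ioo (0:ℝ) 1, 1 := by
      refine setLIntegral_mono measurable_const fun r hr => ?_
      rw [← ENNReal.ofReal_mul hr.1.le]
      refine ENNReal.ofReal_le_one.2 ?_
      have := hr.1; have := hr.2
      rw [← pow_succ']
      exact pow_le_one₀ hr.1.le hr.2.le
    exact ne_top_of_le_ne_top (by simp) this
  have hJ : ∀ c s : ℝ, ∫⁻ p, G c s p = K * ∫⁻ x in Metric.ball (0:E2) 1, ∫⁻ θ in Ioo 0 (2*π),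
      f (c • x + (√(1 - ‖x‖^2) * s) • unitDir θ) := by
    intro c s
    rw [key_lint _ (mG c s), ← lintegral_mul_const _ (by fun_prop)]
    have : Ioo (0:ℝ) 1 = Iio 1 ∩ Ioi 0 := by ext; simp [and_comm]
    rw [this, ← setLIntegral_indicator measurableSet_Iio]
    refine setLIntegral_congr_fun measurableSet_Ioi fun r (hr : 0 < r) => ?_
    have hρ : ∀ x ∈ Metric.ball (0:E2) 1, ∀ θ, ρ (r • x, (r * √(1 - ‖x‖^2)) • unitDir θ) = r := by
      intro x hx θ
      have hx1 : ‖x‖ < 1 := mem_ball_zero_iff.1 hx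
      have h1 : 0 ≤ 1 - ‖x‖^2 := by nlinarith [norm_nonneg x]
      simp only [ρ, norm_smul, norm_unitDir, mul_pow, Real.norm_eq_abs, sq_abs, abs_mul,
        Real.sq_sqrt h1]
      rw [← Real.sqrt_sq hr.le]
      congr 1
      rw [Real.sqrt_sq hr.le]; ring
    have hG : ∀ x ∈ Metric.ball (0:E2) 1, ∀ θ, G c s (r • x, (r * √(1 - ‖x‖^2)) • unitDir θ) =
        if r < 1 then f (c • x + (√(1 - ‖x‖^2) * s) • unitDir θ) else 0 := by
      intro x hx θ
      simp only [G, hρ x hx θ]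
      congr 2
      rw [smul_add, smul_smul, smul_smul, smul_smul, smul_smul]
      congr 2 <;> field_simp
    rw [setLIntegral_congr_fun Metric.isOpen_ball.measurableSet
      (fun x hx => lintegral_congr fun θ => hG x hx θ)]
    by_cases h1 : r < 1
    · simp [h1, mul_assoc]
    · simp [h1]
  have hrot : ∫⁻ p, G c s p = ∫⁻ p, G 1 0 p := by
    rw [← (rot_mp c s h).lintegral_comp (mG 1 0)]
    refine lintegral_congr fun p => ?_
    simp only [G, ρ, rot_norm c s h]
    simp
  rw [hJ, hJ] at hrot
  have := (ENNReal.mul_right_inj hK0 hKt).1 hrot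
  rw [this]
  simp

/-- the generalized flow `η = F_#((1/2π²) 𝓛²⌊B₁(0) × 𝓛¹⌊(0,2π))`, where
`F(x,θ) = ω_{x,θ}`, is incompressible: its time-`t` marginal is the normalized Lebesgue
measure `(1/π) 𝓛²⌊B₁(0)` for every `t ∈ [0,π]`. -/
theorem stmt_14 :
    ∀ t ∈ Set.Icc (0:ℝ) Real.pi,
      Measure.map (fun ω : ℝ → EuclideanSpace ℝ (Fin 2) => ω t)
        (Measure.map (fun p : EuclideanSpace ℝ (Fin 2) × ℝ => brenierPath p.1 p.2)
          ((ENNReal.ofReal (2 * Real.pi ^ 2))⁻¹ •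
            ((volume.restrict (Metric.ball (0 : EuclideanSpace ℝ (Fin 2)) 1)).prod
              (volume.restrict (Set.Ioo (0:ℝ) (2 * Real.pi)))))) =
      (ENNReal.ofReal Real.pi)⁻¹ •
        volume.restrict (Metric.ball (0 : EuclideanSpace ℝ (Fin 2)) 1) := by
  intro t _
  have mu : Measurable unitDir := continuous_unitDir.measurable
  have mF : Measurable fun p : EuclideanSpace ℝ (Fin 2) × ℝ => brenierPath p.1 p.2 := by
    refine measurable_pi_lambda _ fun t => ?_
    unfold brenierPath
    fun_prop
  rw [Measure.map_map (measurable_pi_apply t) mF, Measure.map_smul]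
  ext S hS
  have key := main_lint (Real.cos t) (Real.sin t) (Real.cos_sq_add_sin_sq t) (S.indicator 1)
    (measurable_one.indicator hS)
  have mc := (measurable_pi_apply t).comp mF
  have e1 : Measure.map ((fun ω : ℝ → EuclideanSpace ℝ (Fin 2) => ω t) ∘
      fun p : EuclideanSpace ℝ (Fin 2) × ℝ => brenierPath p.1 p.2)
      ((volume.restrict (Metric.ball (0 : EuclideanSpace ℝ (Fin 2)) 1)).prod
              (volume.restrict (Set.Ioo (0:ℝ) (2 * Real.pi)))) S =
      ENNReal.ofReal (2 * π) * volume.restrict (Metric.ball (0 : EuclideanSpace ℝ (Fin 2)) 1) S := by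
    rw [← lintegral_indicator_one hS, lintegral_map (measurable_one.indicator hS) mc]
    refine (lintegral_prod _ ((measurable_one.indicator hS).comp mc).aemeasurable).trans ?_
    refine key.trans ?_
    simp only [lintegral_const, Measure.restrict_apply_univ, Real.volume_Ioo, sub_zero]
    rw [lintegral_mul_const _ (measurable_one.indicator hS), lintegral_indicator_one hS, mul_comm]
  rw [Measure.smul_apply, Measure.smul_apply, e1, smul_eq_mul, smul_eq_mul, ← mul_assoc]
  congr 1
  have hp := Real.pi_pos
  rw [← ENNReal.ofReal_inv_of_pos (by positivity), ← ENNReal.ofReal_inv_of_pos hp,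
    ← ENNReal.ofReal_mul (by positivity)]
  congr 1
  field_simp
end

section
/- Let $\Omega = C([0,1];K)$ for a compact set $K \subset \mathbb{R}^d$. The action functional $\mathcal{A}(\eta) = \int_\Omega \int_0^1 \frac{1}{2}|\dot\omega(t)|^2\,dt\,d\eta(\omega)$ (set to $+\infty$ on paths not in $H^1$) is lower semicontinuous with respect to weak (narrow) convergence of probability measures on $\Omega$, and its sublevel sets $\{\eta : \mathcal{A}(\eta) \leq C\}$ intersected with any closed set of constraints are compact. Consequently, if there exists at least one incompressible generalized flow with finite action connecting two given endpoint plans, then a minimizer of the action under these constraints exists. -/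
open Set MeasureTheory

/-- The `H¹` energy `∫₀¹ ½|ω̇|²` of a continuous path into `K ⊆ ℝᵈ`, defined as the
supremum over partitions of `∑ |ω(tᵢ₊₁)-ω(tᵢ)|²/(2(tᵢ₊₁-tᵢ))`; it equals `+∞` exactly on
non-`H¹` paths. -/
noncomputable def pathEnergy {d : ℕ} (K : Set (EuclideanSpace ℝ (Fin d)))
    (ω : C(Set.Icc (0:ℝ) 1, ↥K)) : ENNReal :=
  ⨆ (n : ℕ) (τ : {σ : Fin (n+1) → Set.Icc (0:ℝ) 1 // StrictMono σ}),
    ∑ i : Fin n, ENNReal.ofReal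
      (‖((ω (τ.1 i.succ) : K) : EuclideanSpace ℝ (Fin d)) -
          ((ω (τ.1 i.castSucc) : K) : EuclideanSpace ℝ (Fin d))‖ ^ 2 /
        (2 * (((τ.1 i.succ : Set.Icc (0:ℝ) 1) : ℝ) - ((τ.1 i.castSucc : Set.Icc (0:ℝ) 1) : ℝ))))

/-- Admissibility: incompressibility (all time marginals equal `μK`) plus the endpoint
constraint `(e₀,e₁)_# η = γ`. -/
def AdmissibleFlow {d : ℕ} (K : Set (EuclideanSpace ℝ (Fin d)))
    [MeasurableSpace C(Set.Icc (0:ℝ) 1, ↥K)]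
    (μK : Measure ↥K) (γ : Measure (↥K × ↥K))
    (η : ProbabilityMeasure C(Set.Icc (0:ℝ) 1, ↥K)) : Prop :=
  (∀ t : Set.Icc (0:ℝ) 1,
      Measure.map (fun ω : C(Set.Icc (0:ℝ) 1, ↥K) => ω t) (η : Measure _) = μK) ∧
  Measure.map (fun ω : C(Set.Icc (0:ℝ) 1, ↥K) =>
      (ω ⟨0, by norm_num⟩, ω ⟨1, by norm_num⟩)) (η : Measure _) = γ

lemma lintegral_layercake_aux {X : Type*} [MeasurableSpace X] (μ : Measure X) [SFinite μ]
    (f : X → ENNReal) (hf : Measurable f) :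
    ∫⁻ x, f x ∂μ = ∫⁻ t in Set.Ioi (0:ℝ), μ {x | ENNReal.ofReal t < f x} := by
  have hS : MeasurableSet {p : X × ℝ | ENNReal.ofReal p.2 < f p.1} :=
    measurableSet_lt (ENNReal.measurable_ofReal.comp measurable_snd) (hf.comp measurable_fst)
  have h1 := Measure.prod_apply (μ := μ) (ν := volume.restrict (Set.Ioi (0:ℝ))) hS
  have h2 := Measure.prod_apply_symm (μ := μ) (ν := volume.restrict (Set.Ioi (0:ℝ))) hS
  rw [h1] at h2
  have h3 : ∀ x, (volume.restrict (Set.Ioi (0:ℝ)))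
      (Prod.mk x ⁻¹' {p : X × ℝ | ENNReal.ofReal p.2 < f p.1}) = f x := by
    intro x
    rw [Measure.restrict_apply' measurableSet_Ioi]
    rcases eq_or_ne (f x) ⊤ with h | h
    · have : (Prod.mk x ⁻¹' {p : X × ℝ | ENNReal.ofReal p.2 < f p.1}) ∩ Set.Ioi 0
          = Set.Ioi (0:ℝ) := by
        ext t; simp [h]
      rw [this, h, Real.volume_Ioi]
    · have : (Prod.mk x ⁻¹' {p : X × ℝ | ENNReal.ofReal p.2 < f p.1}) ∩ Set.Ioi 0
          = Set.Ioo (0:ℝ) (f x).toReal := by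
        ext t
        simp only [Set.mem_inter_iff, Set.mem_preimage, Set.mem_Ioi, Set.mem_Ioo]
        constructor
        · rintro ⟨h1, h2⟩
          exact ⟨h2, (ENNReal.ofReal_lt_iff_lt_toReal h2.le h).1 h1⟩
        · rintro ⟨h1, h2⟩
          exact ⟨(ENNReal.ofReal_lt_iff_lt_toReal h1.le h).2 h2, h1⟩
      rw [this, Real.volume_Ioo, sub_zero, ENNReal.ofReal_toReal h]
  simp only [h3] at h2
  exact h2

lemma lsc_lintegral_aux {X : Type*} [TopologicalSpace X] [TopologicalSpace.PseudoMetrizableSpace X]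
    [TopologicalSpace.SeparableSpace X] [MeasurableSpace X] [BorelSpace X]
    (f : X → ENNReal) (hf : LowerSemicontinuous f) :
    LowerSemicontinuous (fun η : ProbabilityMeasure X => ∫⁻ x, f x ∂(η : Measure X)) := by
  rw [lowerSemicontinuous_iff_le_liminf]
  intro η
  have hm := hf.measurable
  simp only [lintegral_layercake_aux _ f hm]
  have hopen : ∀ t : ℝ, IsOpen {x | ENNReal.ofReal t < f x} := fun t =>
    hf.isOpen_preimage (ENNReal.ofReal t)
  calc ∫⁻ t in Set.Ioi (0:ℝ), (η : Measure X) {x | ENNReal.ofReal t < f x}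
      ≤ ∫⁻ t in Set.Ioi (0:ℝ), Filter.liminf (fun ν : ProbabilityMeasure X =>
          (ν : Measure X) {x | ENNReal.ofReal t < f x}) (nhds η) := by
        apply lintegral_mono
        intro t
        exact ProbabilityMeasure.le_liminf_measure_open_of_tendsto Filter.tendsto_id (hopen t)
    _ ≤ _ := by
        apply lintegral_liminf_le'
        intro ν
        apply Measurable.aemeasurable
        apply Antitone.measurable
        intro s t hst
        apply measure_mono
        intro x hx
        exact lt_of_le_of_lt (ENNReal.ofReal_le_ofReal hst) hx

lemma lsc_pathEnergy_aux {d : ℕ} (K : Set (EuclideanSpace ℝ (Fin d))) :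
    LowerSemicontinuous (pathEnergy K) := by
  unfold pathEnergy
  refine lowerSemicontinuous_iSup fun n => lowerSemicontinuous_iSup fun τ => ?_
  apply Continuous.lowerSemicontinuous
  refine continuous_finsetSum _ fun i _ => ?_
  refine ENNReal.continuous_ofReal.comp ?_
  refine Continuous.div_const ?_ _
  have h : ∀ t : Set.Icc (0:ℝ) 1, Continuous (fun ω : C(Set.Icc (0:ℝ) 1, ↥K) =>
      ((ω t : K) : EuclideanSpace ℝ (Fin d))) := fun t =>
    continuous_subtype_val.comp (continuous_eval_const t)
  exact ((h _).sub (h _)).norm.pow 2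

lemma holder_aux {d : ℕ} (K : Set (EuclideanSpace ℝ (Fin d))) (R : ℝ) (hR : 0 ≤ R)
    (ω : C(Set.Icc (0:ℝ) 1, ↥K)) (h : pathEnergy K ω ≤ ENNReal.ofReal R) (s t : Set.Icc (0:ℝ) 1) :
    dist (ω s) (ω t) ^ 2 ≤ 2 * R * dist s t := by
  have key : ∀ s t : Set.Icc (0:ℝ) 1, s < t → dist (ω s) (ω t) ^ 2 ≤ 2 * R * dist s t := by
    intro s t hst
    have hmono : StrictMono (![s, t] : Fin (1+1) → Set.Icc (0:ℝ) 1) := by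
      rw [Fin.strictMono_iff_lt_succ]
      intro i
      fin_cases i
      simpa using hst
    have h1 : (∑ i : Fin 1, ENNReal.ofReal
      (‖((ω ((![s, t] : Fin (1+1) → Set.Icc (0:ℝ) 1) i.succ) : K) : EuclideanSpace ℝ (Fin d)) -
          ((ω ((![s, t] : Fin (1+1) → Set.Icc (0:ℝ) 1) i.castSucc) : K) :
            EuclideanSpace ℝ (Fin d))‖ ^ 2 /
        (2 * ((((![s, t] : Fin (1+1) → Set.Icc (0:ℝ) 1) i.succ : Set.Icc (0:ℝ) 1) : ℝ) -
          (((![s, t] : Fin (1+1) → Set.Icc (0:ℝ) 1) i.castSucc : Set.Icc (0:ℝ) 1) : ℝ)))))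
        ≤ pathEnergy K ω := by
      unfold pathEnergy
      exact le_iSup₂_of_le 1 ⟨_, hmono⟩ le_rfl
    have h2 := h1.trans h
    simp only [Fin.sum_univ_one] at h2
    rw [ENNReal.ofReal_le_ofReal_iff hR] at h2
    have hst' : (s:ℝ) < t := hst
    change ‖((ω t : K) : EuclideanSpace ℝ (Fin d)) - (ω s : K)‖ ^ 2 / (2 * ((t:ℝ) - s)) ≤ R at h2
    rw [div_le_iff₀ (by linarith)] at h2
    rw [dist_comm, dist_comm s t, Subtype.dist_eq, Subtype.dist_eq, dist_eq_norm, Real.dist_eq,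
      abs_of_pos (by linarith)]
    linarith
  rcases lt_trichotomy s t with h' | h' | h'
  · exact key s t h'
  · simp [h']
  · rw [dist_comm, dist_comm s t]; exact key t s h'

lemma compact_holder_aux {d : ℕ} (K : Set (EuclideanSpace ℝ (Fin d))) (hK : IsCompact K)
    (R : ℝ) : IsCompact {ω : C(Set.Icc (0:ℝ) 1, ↥K) |
      ∀ s t, dist (ω s) (ω t) ^ 2 ≤ 2 * R * dist s t} := by
  have : CompactSpace K := isCompact_iff_compactSpace.1 hK
  have hcont : ∀ x : Set.Icc (0:ℝ) 1, ∀ ε > 0, ∀ᶠ y in nhds x, 2 * R * dist x y < ε ^ 2 := by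
    intro x ε hε
    have : Filter.Tendsto (fun y => 2 * R * dist x y) (nhds x) (nhds (2 * R * dist x x)) :=
      Continuous.tendsto (by fun_prop) x
    apply this.eventually_lt_const
    simp; positivity
  apply ArzelaAscoli.isCompact_of_equicontinuous
  · have : (ContinuousMap.toFun '' {ω : C(Set.Icc (0:ℝ) 1, ↥K) |
      ∀ s t, dist (ω s) (ω t) ^ 2 ≤ 2 * R * dist s t}) =
      {f : Set.Icc (0:ℝ) 1 → K | ∀ s t, dist (f s) (f t) ^ 2 ≤ 2 * R * dist s t} := by
      ext f
      constructor
      · rintro ⟨ω, h, rfl⟩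
        exact h
      · intro h
        refine ⟨⟨f, ?_⟩, h, rfl⟩
        rw [continuous_iff_continuousAt]
        intro x
        rw [ContinuousAt, Metric.tendsto_nhds]
        intro ε hε
        filter_upwards [hcont x ε hε] with y hy
        rw [dist_comm]
        exact lt_of_pow_lt_pow_left₀ 2 hε.le ((h x y).trans_lt hy)
    rw [this]
    apply IsClosed.isCompact
    have h2 : {f : Set.Icc (0:ℝ) 1 → K | ∀ s t, dist (f s) (f t) ^ 2 ≤ 2 * R * dist s t} =
      ⋂ s, ⋂ t, {f : Set.Icc (0:ℝ) 1 → K | dist (f s) (f t) ^ 2 ≤ 2 * R * dist s t} := by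
      ext f; simp only [Set.mem_iInter]; rfl
    rw [h2]
    refine isClosed_iInter fun s => isClosed_iInter fun t => ?_
    exact isClosed_le (by fun_prop) continuous_const
  · intro x
    rw [Metric.equicontinuousAt_iff_right]
    intro ε hε
    filter_upwards [hcont x ε hε] with y hy
    intro ω
    exact lt_of_pow_lt_pow_left₀ 2 hε.le ((ω.2 x y).trans_lt hy)

lemma compact_sublevel_aux {d : ℕ} (K : Set (EuclideanSpace ℝ (Fin d))) (hK : IsCompact K)
    [MeasurableSpace C(Set.Icc (0:ℝ) 1, ↥K)] [BorelSpace C(Set.Icc (0:ℝ) 1, ↥K)]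
    (C : ENNReal) (hC : C ≠ ⊤) :
    IsCompact {η : ProbabilityMeasure C(Set.Icc (0:ℝ) 1, ↥K) |
        ∫⁻ ω, pathEnergy K ω ∂(η : Measure _) ≤ C} := by
  have hclosed : IsClosed {η : ProbabilityMeasure C(Set.Icc (0:ℝ) 1, ↥K) |
        ∫⁻ ω, pathEnergy K ω ∂(η : Measure _) ≤ C} :=
    (lsc_lintegral_aux _ (lsc_pathEnergy_aux K)).isClosed_preimage C
  rw [← hclosed.closure_eq]
  apply isCompact_closure_of_isTightMeasureSet
  rw [isTightMeasureSet_iff_exists_isCompact_measure_compl_le]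
  intro ε hε
  rcases eq_or_ne ε ⊤ with rfl | hε'
  · exact ⟨∅, isCompact_empty, fun _ _ => le_top⟩
  have hne : C / ε ≠ ⊤ := ENNReal.div_ne_top hC hε.ne'
  refine ⟨_, compact_holder_aux K hK ((C / ε).toReal + 1), ?_⟩
  rintro _ ⟨η, hη, rfl⟩
  have hR : (0:ℝ) < (C / ε).toReal + 1 := by positivity
  have h0 : ENNReal.ofReal ((C / ε).toReal + 1) ≠ 0 := by simpa using hR
  calc (η : Measure C(Set.Icc (0:ℝ) 1, ↥K)) _
      ≤ (η : Measure _) {ω | ENNReal.ofReal ((C / ε).toReal + 1) ≤ pathEnergy K ω} := by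
        apply measure_mono
        intro ω hω
        by_contra hlt
        exact hω (holder_aux K _ hR.le ω (not_le.1 hlt).le)
    _ ≤ (∫⁻ ω, pathEnergy K ω ∂(η : Measure _)) / ENNReal.ofReal ((C / ε).toReal + 1) :=
        meas_ge_le_lintegral_div (lsc_pathEnergy_aux K).measurable.aemeasurable h0
          ENNReal.ofReal_ne_top
    _ ≤ C / ENNReal.ofReal ((C / ε).toReal + 1) := ENNReal.div_le_div_right hη _
    _ ≤ ε := by
        apply ENNReal.div_le_of_le_mul'
        rw [← ENNReal.div_le_iff hε.ne' hε']
        calc C / ε = ENNReal.ofReal (C / ε).toReal := (ENNReal.ofReal_toReal hne).symm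
          _ ≤ _ := ENNReal.ofReal_le_ofReal (by linarith)

lemma isClosed_map_eq_aux {X Y : Type*} [TopologicalSpace X] [MeasurableSpace X] [BorelSpace X]
    [TopologicalSpace Y] [TopologicalSpace.PseudoMetrizableSpace Y] [MeasurableSpace Y]
    [BorelSpace Y]
    (f : X → Y) (hf : Continuous f) (μ : Measure Y) [IsProbabilityMeasure μ] :
    IsClosed {η : ProbabilityMeasure X | Measure.map f (η : Measure X) = μ} := by
  obtain ⟨P, hP⟩ : ∃ P : ProbabilityMeasure Y, (P : Measure Y) = μ := ⟨⟨μ, inferInstance⟩, rfl⟩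
  have : {η : ProbabilityMeasure X | Measure.map f (η : Measure X) = μ} =
      (fun ν : ProbabilityMeasure X => ν.map hf.measurable.aemeasurable) ⁻¹' {P} := by
    ext η
    rw [Set.mem_preimage, Set.mem_singleton_iff, ← hP]
    exact ⟨fun h => Subtype.ext h, fun h => congrArg (fun Q : ProbabilityMeasure Y =>
      (Q : Measure Y)) h⟩
  rw [this]
  exact isClosed_singleton.preimage (ProbabilityMeasure.continuous_map hf)

/-- the action is narrowly lower semicontinuous, has compact sublevel sets
within any closed constraint set, and hence admits a minimizer among incompressible
generalized flows with prescribed endpoint plan, provided one such flow with finite action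
exists. -/
theorem stmt_16 {d : ℕ} (K : Set (EuclideanSpace ℝ (Fin d))) (hK : IsCompact K)
    [MeasurableSpace C(Set.Icc (0:ℝ) 1, ↥K)] [BorelSpace C(Set.Icc (0:ℝ) 1, ↥K)]
    (μK : Measure ↥K) [IsProbabilityMeasure μK]
    (γ : Measure (↥K × ↥K)) [IsProbabilityMeasure γ] :
    LowerSemicontinuous (fun η : ProbabilityMeasure C(Set.Icc (0:ℝ) 1, ↥K) =>
      ∫⁻ ω, pathEnergy K ω ∂(η : Measure _)) ∧
    (∀ (C : ℝ) (F : Set (ProbabilityMeasure C(Set.Icc (0:ℝ) 1, ↥K))), IsClosed F →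
      IsCompact ({η : ProbabilityMeasure C(Set.Icc (0:ℝ) 1, ↥K) |
        ∫⁻ ω, pathEnergy K ω ∂(η : Measure _) ≤ ENNReal.ofReal C} ∩ F)) ∧
    ((∃ η₀ : ProbabilityMeasure C(Set.Icc (0:ℝ) 1, ↥K), AdmissibleFlow K μK γ η₀ ∧
        ∫⁻ ω, pathEnergy K ω ∂(η₀ : Measure _) < ⊤) →
      ∃ ηmin : ProbabilityMeasure C(Set.Icc (0:ℝ) 1, ↥K), AdmissibleFlow K μK γ ηmin ∧
        ∀ η : ProbabilityMeasure C(Set.Icc (0:ℝ) 1, ↥K), AdmissibleFlow K μK γ η →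
          ∫⁻ ω, pathEnergy K ω ∂(ηmin : Measure _) ≤
            ∫⁻ ω, pathEnergy K ω ∂(η : Measure _)) := by
  have hlsc := lsc_lintegral_aux _ (lsc_pathEnergy_aux K)
  refine ⟨hlsc, fun C F hF => (compact_sublevel_aux K hK _ ENNReal.ofReal_ne_top).inter_right hF,
    ?_⟩
  rintro ⟨η₀, hη₀, hfin⟩
  have hadm : IsClosed {η : ProbabilityMeasure C(Set.Icc (0:ℝ) 1, ↥K) |
      AdmissibleFlow K μK γ η} := by
    have : {η : ProbabilityMeasure C(Set.Icc (0:ℝ) 1, ↥K) | AdmissibleFlow K μK γ η} =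
        (⋂ t : Set.Icc (0:ℝ) 1, {η : ProbabilityMeasure C(Set.Icc (0:ℝ) 1, ↥K) |
          Measure.map (fun ω : C(Set.Icc (0:ℝ) 1, ↥K) => ω t) (η : Measure _) = μK}) ∩
        {η : ProbabilityMeasure C(Set.Icc (0:ℝ) 1, ↥K) |
          Measure.map (fun ω : C(Set.Icc (0:ℝ) 1, ↥K) =>
            (ω ⟨0, by norm_num⟩, ω ⟨1, by norm_num⟩)) (η : Measure _) = γ} := by
      ext η
      simp [AdmissibleFlow]
    rw [this]
    refine (isClosed_iInter fun t => isClosed_map_eq_aux _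
      (continuous_eval_const t) _).inter (isClosed_map_eq_aux _
      ((continuous_eval_const _).prodMk (continuous_eval_const _)) _)
  have hcpt := (compact_sublevel_aux K hK _ hfin.ne).inter_right hadm
  have hmem : η₀ ∈ {η : ProbabilityMeasure C(Set.Icc (0:ℝ) 1, ↥K) |
      ∫⁻ ω, pathEnergy K ω ∂(η : Measure _) ≤ ∫⁻ ω, pathEnergy K ω ∂(η₀ : Measure _)} :=
    le_refl (∫⁻ ω, pathEnergy K ω ∂(η₀ : Measure C(Set.Icc (0:ℝ) 1, ↥K)))
  have hne := Set.nonempty_of_mem (Set.mem_inter hmem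
    (show η₀ ∈ {η : ProbabilityMeasure C(Set.Icc (0:ℝ) 1, ↥K) | AdmissibleFlow K μK γ η} from hη₀))
  obtain ⟨η, hη, hmin⟩ := LowerSemicontinuousOn.exists_isMinOn hne hcpt
    (hlsc.lowerSemicontinuousOn _)
  refine ⟨η, hη.2, fun ν hν => ?_⟩
  rcases le_total (∫⁻ ω, pathEnergy K ω ∂(ν : Measure C(Set.Icc (0:ℝ) 1, ↥K)))
    (∫⁻ ω, pathEnergy K ω ∂(η₀ : Measure C(Set.Icc (0:ℝ) 1, ↥K))) with h | h
  · exact hmin ⟨h, hν⟩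
  · exact le_trans hη.1 h
end
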